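/- Let φ : (ℝ^m,0) → (ℝ^m,0) and Φ : (ℝ^n,0) → (ℝ^n,0) be diffeomorphism-germs such that g := Φ∘f∘φ again satisfies the normalization conditions (rank d(g_1,…,g_{m−1})_0 = m−1 and (dg_{m−1+i})_0 = 0 for i = 1,…,n−m+1), and let Λ_g denote the map built from g in the same way as Λ is built from f. Then rank d(Λ_g)_0 = n−m+1 if and only if rank dΛ_0 = n−m+1; i.e., non-degeneracy of the singular point 0 does not depend on the choice of coordinate systems on source and target satisfying the normalization conditions. -/

import Mathlib

open Filter Topology Matrix

noncomputable section

/-- The `q`-th component of `f` (`0`-indexed), or `0` if `q` is out of range. -/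
def comp {m n : ℕ} (f : (Fin m → ℝ) → (Fin n → ℝ)) (q : ℕ) : (Fin m → ℝ) → ℝ :=
  fun x => if h : q < n then f x ⟨q, h⟩ else 0

/-- The `q`-th coordinate of `x` (`0`-indexed), or `0` if `q` is out of range. -/
def xhat {m : ℕ} (x : Fin m → ℝ) (q : ℕ) : ℝ := if h : q < m then x ⟨q, h⟩ else 0

/-- The partial derivative of `g` at `p` in the `q`-th coordinate direction. -/
def pd {m : ℕ} (g : (Fin m → ℝ) → ℝ) (p : Fin m → ℝ) (q : ℕ) : ℝ :=
  fderiv ℝ g p (fun l : Fin m => if l.val = q then 1 else 0)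

/-- The Jacobian matrix of `f` at `p`; its rank is the rank of `df_p`. -/
def jac {m n : ℕ} (f : (Fin m → ℝ) → (Fin n → ℝ)) (p : Fin m → ℝ) : Matrix (Fin n) (Fin m) ℝ :=
  Matrix.of fun i l => pd (comp f i.val) p l.val

/-- `lam f i` is the paper's `λ_{i+1}` (here `i` is `0`-indexed, `0 ≤ i ≤ n-m`):
the determinant of the `m×m` matrix whose rows are the gradients of
`f_0, …, f_{m-2}, f_{m-1+i}` (`0`-indexed components). -/
def lam {m n : ℕ} (f : (Fin m → ℝ) → (Fin n → ℝ)) (i : ℕ) (p : Fin m → ℝ) : ℝ :=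
  Matrix.det (Matrix.of fun (k l : Fin m) =>
    pd (comp f (if k.val < m - 1 then k.val else m - 1 + i)) p l.val)

/-- `Λ = (λ_1, …, λ_{n-m+1}) : ℝ^m → ℝ^{n-m+1}`. -/
def Lam {m n : ℕ} (f : (Fin m → ℝ) → (Fin n → ℝ)) (p : Fin m → ℝ) : Fin (n - m + 1) → ℝ :=
  fun i => lam f i.val p

/-- The Jacobian matrix of `Λ` at `p`. -/
def dLam {m n : ℕ} (f : (Fin m → ℝ) → (Fin n → ℝ)) (p : Fin m → ℝ) :
    Matrix (Fin (n - m + 1)) (Fin m) ℝ :=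
  Matrix.of fun i l => pd (fun x => Lam f x i) p l.val

/-- `etaIter f η j = η^jΛ`, the `j`-fold iterated directional derivative of `Λ` along `η`. -/
def etaIter {m n : ℕ} (f : (Fin m → ℝ) → (Fin n → ℝ)) (η : (Fin m → ℝ) → (Fin m → ℝ)) :
    ℕ → (Fin m → ℝ) → (Fin (n - m + 1) → ℝ)
  | 0 => Lam f
  | j + 1 => fun p => fderiv ℝ (etaIter f η j) p (η p)

/-- The Jacobian matrix of `(Λ, ηΛ, …, η^jΛ) : ℝ^m → ℝ^{(j+1)(n-m+1)}` at `p`. -/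
def stackJac {m n : ℕ} (f : (Fin m → ℝ) → (Fin n → ℝ)) (η : (Fin m → ℝ) → (Fin m → ℝ))
    (j : ℕ) (p : Fin m → ℝ) : Matrix (Fin (j + 1) × Fin (n - m + 1)) (Fin m) ℝ :=
  Matrix.of fun si l => pd (fun x => etaIter f η si.1.val x si.2) p l.val

/-- A diffeomorphism-germ `(ℝ^k,0) → (ℝ^k,0)`: it fixes `0`, is smooth at `0` and its
differential at `0` is invertible (so by the inverse function theorem it is a germ of a
diffeomorphism). -/
def IsDiffeoGerm {k : ℕ} (σ : (Fin k → ℝ) → (Fin k → ℝ)) : Prop :=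
  σ 0 = 0 ∧ ContDiffAt ℝ (⊤ : ℕ∞) σ 0 ∧ LinearMap.det ((fderiv ℝ σ 0).toLinearMap) ≠ 0

/-- An orientation-preserving diffeomorphism-germ `(ℝ^k,0) → (ℝ^k,0)`. -/
def IsOPDiffeoGerm {k : ℕ} (σ : (Fin k → ℝ) → (Fin k → ℝ)) : Prop :=
  σ 0 = 0 ∧ ContDiffAt ℝ (⊤ : ℕ∞) σ 0 ∧ 0 < LinearMap.det ((fderiv ℝ σ 0).toLinearMap)

/-- `A`-equivalence of map-germs at `0`. -/
def AEquiv {m n : ℕ} (f g : (Fin m → ℝ) → (Fin n → ℝ)) : Prop :=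
  ∃ (φ : (Fin m → ℝ) → (Fin m → ℝ)) (Φ : (Fin n → ℝ) → (Fin n → ℝ)),
    IsDiffeoGerm φ ∧ IsDiffeoGerm Φ ∧ ∀ᶠ x in 𝓝 0, Φ (f (φ x)) = g x

/-- The Morin normal form `h_{0,r} : (ℝ^m,0) → (ℝ^n,0)` (all indices `0`-indexed):
`h_{0,r}(x) = (x_1, …, x_{m-1}, h_1(x), …, h_{n-m+1}(x))` with
`h_i(x) = Σ_{j=1}^r x_{(i-1)r+j} x_m^j` for `i = 1, …, n-m` and
`h_{n-m+1}(x) = Σ_{j=1}^{r-1} x_{(n-m)r+j} x_m^j + x_m^{r+1}`. -/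
def hMorinNF (m n r : ℕ) : (Fin m → ℝ) → (Fin n → ℝ) := fun x k =>
  if k.val < m - 1 then xhat x k.val
  else if k.val - (m - 1) < n - m then
    ∑ j ∈ Finset.range r, xhat x ((k.val - (m - 1)) * r + j) * (xhat x (m - 1)) ^ (j + 1)
  else
    (∑ j ∈ Finset.range (r - 1), xhat x ((n - m) * r + j) * (xhat x (m - 1)) ^ (j + 1))
      + (xhat x (m - 1)) ^ (r + 1)

/-- The normal form `h_{r,(ε₁,ε₂)}(x) = (ε₁x_1, x_2, …, x_{m-1},
ε₁x_1x_m + Σ_{j=2}^r x_jx_m^j, h_2(x), …, h_{n-m}(x), ε₂h_{n-m+1}(x))`. -/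
def hSign (m n r : ℕ) (e1 e2 : ℝ) : (Fin m → ℝ) → (Fin n → ℝ) := fun x k =>
  if k.val = 0 then e1 * xhat x 0
  else if k.val < m - 1 then xhat x k.val
  else if k.val = m - 1 then
    e1 * xhat x 0 * xhat x (m - 1)
      + ∑ j ∈ Finset.Ico 1 r, xhat x j * (xhat x (m - 1)) ^ (j + 1)
  else if k.val - (m - 1) < n - m then
    ∑ j ∈ Finset.range r, xhat x ((k.val - (m - 1)) * r + j) * (xhat x (m - 1)) ^ (j + 1)
  else
    e2 * ((∑ j ∈ Finset.range (r - 1), xhat x ((n - m) * r + j) * (xhat x (m - 1)) ^ (j + 1))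
      + (xhat x (m - 1)) ^ (r + 1))

theorem rank_eq_iff_mulVec_surjective {a b : ℕ} (A : Matrix (Fin a) (Fin b) ℝ) :
    A.rank = a ↔ Function.Surjective A.mulVec := by
  rw [show A.mulVec = A.mulVecLin from rfl, ← LinearMap.range_eq_top, Matrix.rank]
  constructor
  · intro h
    exact Submodule.eq_top_of_finrank_eq (by simpa using h)
  · intro h
    rw [h]
    simp

theorem finrank_ker_mulVecLin_eq_one {m : ℕ} (hm : 0 < m) {M : Matrix (Fin (m - 1)) (Fin m) ℝ}
    (hM : M.rank = m - 1) : Module.finrank ℝ (LinearMap.ker M.mulVecLin) = 1 := by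
  have h := LinearMap.finrank_range_add_finrank_ker M.mulVecLin
  rw [Matrix.rank] at hM
  rw [hM] at h
  simp only [Module.finrank_fintype_fun_eq_card, Fintype.card_fin] at h
  omega

theorem exists_smul_eq_of_mulVec_eq_zero {m : ℕ} (hm : 0 < m)
    {M : Matrix (Fin (m - 1)) (Fin m) ℝ} (hM : M.rank = m - 1) {v x : Fin m → ℝ} (hv : v ≠ 0)
    (hMv : M *ᵥ v = 0) (hMx : M *ᵥ x = 0) : ∃ t : ℝ, t • v = x := by
  have h1 := finrank_ker_mulVecLin_eq_one hm hM
  obtain ⟨t, ht⟩ := (finrank_eq_one_iff_of_nonzero'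
    (⟨v, hMv⟩ : LinearMap.ker M.mulVecLin) (by simpa [Subtype.ext_iff] using hv)).1 h1 ⟨x, hMx⟩
  exact ⟨t, by simpa [Subtype.ext_iff] using ht⟩

theorem pd_comp {m n : ℕ} {F : (Fin m → ℝ) → (Fin n → ℝ)} {p : Fin m → ℝ}
    (hF : DifferentiableAt ℝ F p) {q : ℕ} (hq : q < n) (l : Fin m) :
    pd (comp F q) p l.val = fderiv ℝ F p (Pi.single l 1) ⟨q, hq⟩ := by
  have h : comp F q = fun x => F x ⟨q, hq⟩ := by
    funext x
    simp [_root_.comp, hq]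
  have he : (fun k : Fin m => if k.val = l.val then (1 : ℝ) else 0) = Pi.single l 1 := by
    funext k
    simp [Pi.single_apply, Fin.ext_iff]
  rw [pd, h, he, (hasFDerivAt_pi'.1 hF.hasFDerivAt ⟨q, hq⟩).fderiv]
  rfl

theorem sum_apply_single_mul {m : ℕ} (L : (Fin m → ℝ) →L[ℝ] ℝ) (x : Fin m → ℝ) :
    ∑ l, L (Pi.single l 1) * x l = L x := by
  conv_rhs => rw [pi_eq_sum_univ' x]
  simp only [map_sum, map_smul, smul_eq_mul]
  refine Finset.sum_congr rfl fun l _ => ?_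
  rw [mul_comm]

theorem differentiableAt_det {E : Type*} [NormedAddCommGroup E] [NormedSpace ℝ E] {m : ℕ}
    {P : E → Matrix (Fin m) (Fin m) ℝ} {p : E}
    (hP : ∀ k l, DifferentiableAt ℝ (fun x => P x k l) p) :
    DifferentiableAt ℝ (fun x => (P x).det) p := by
  simp only [Matrix.det_apply]
  refine DifferentiableAt.fun_sum fun s _ => ?_
  refine DifferentiableAt.const_smul ?_ _
  exact (HasFDerivAt.finsetProd fun k _ => (hP (s k) k).hasFDerivAt).differentiableAt

/-- The derivative of a determinant at a point where the row `k` vanishes. -/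
theorem fderiv_det_of_row_eq_zero {E : Type*} [NormedAddCommGroup E] [NormedSpace ℝ E] {m : ℕ}
    {P : E → Matrix (Fin m) (Fin m) ℝ} {p : E}
    (hP : ∀ k l, DifferentiableAt ℝ (fun x => P x k l) p) (k : Fin m)
    (hk : ∀ l, P p k l = 0) (w : E) :
    fderiv ℝ (fun x => (P x).det) p w
      = ∑ l, fderiv ℝ (fun x => P x k l) p w * (P p).adjugate l k := by
  have hadj : ∀ l, DifferentiableAt ℝ (fun x => (P x).adjugate l k) p := by
    intro l
    simp only [Matrix.adjugate_apply]
    refine differentiableAt_det fun i j => ?_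
    simp only [Matrix.updateRow_apply]
    split_ifs
    · exact differentiableAt_const _
    · exact hP i j
  have h : (fun x => (P x).det) = fun x => ∑ l, P x k l * (P x).adjugate l k := by
    funext x
    exact Matrix.det_eq_sum_mul_adjugate_row _ k
  rw [h, fderiv_fun_sum fun l _ => (hP k l).fun_mul (hadj l)]
  simp only [_root_.sum_apply]
  refine Finset.sum_congr rfl fun l _ => ?_
  rw [fderiv_fun_mul (hP k l) (hadj l)]
  simp [hk, mul_comm]

/-- The cofactor vector of the row `k` is nonzero if the other rows are independent. -/
theorem adjugate_col_ne_zero {m : ℕ} (k : Fin m) (P : Matrix (Fin m) (Fin m) ℝ)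
    {v : Fin m → ℝ} (hv : v ≠ 0)
    (hker : ∀ x : Fin m → ℝ, (∀ i, i ≠ k → P i ⬝ᵥ x = 0) → ∃ t : ℝ, t • v = x) :
    (fun l => P.adjugate l k) ≠ 0 := by
  intro h0
  have hdet : (P.updateRow k v).det = 0 := by
    rw [Matrix.det_eq_sum_mul_adjugate_row _ k]
    refine Finset.sum_eq_zero fun l _ => ?_
    have : (P.updateRow k v).adjugate l k = P.adjugate l k := by
      simp [Matrix.adjugate_apply]
    rw [this, congrFun h0 l]
    simp
  obtain ⟨x, hx, hPx⟩ := Matrix.exists_mulVec_eq_zero_iff.2 hdet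
  obtain ⟨t, rfl⟩ := hker x fun i hi => by
    have := congrFun hPx i
    simpa [Matrix.mulVec, Matrix.updateRow_apply, hi] using this
  have := congrFun hPx k
  simp only [Matrix.mulVec, Matrix.updateRow_self, dotProduct_smul, smul_eq_mul,
    Pi.zero_apply, mul_eq_zero, dotProduct_self_eq_zero, hv, or_false] at this
  simp [this] at hx

/-- Coordinate-free form of non-degeneracy: the second intrinsic derivative in the kernel
direction `v` is onto the cokernel of the differential. -/
def SecondDerivOnto {m n : ℕ} (F : (Fin m → ℝ) → (Fin n → ℝ)) (v : Fin m → ℝ) : Prop :=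
  ∀ y, ∃ w u, fderiv ℝ (fderiv ℝ F) 0 w v + fderiv ℝ F 0 u = y

section Normalized

variable {m n : ℕ} {F : (Fin m → ℝ) → (Fin n → ℝ)}

theorem gradient_matrix_mulVec (hmn : m < n) (hF : DifferentiableAt ℝ F 0) (x : Fin m → ℝ)
    (k : Fin (m - 1)) :
    ((Matrix.of fun (k : Fin (m - 1)) (l : Fin m) => pd (comp F k.val) 0 l.val) *ᵥ x) k
      = fderiv ℝ F 0 x ⟨k.val, by omega⟩ := by
  have h := sum_apply_single_mul
    ((ContinuousLinearMap.proj (R := ℝ) (φ := fun _ : Fin n => ℝ) ⟨k.val, by omega⟩).comp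
      (fderiv ℝ F 0)) x
  simp only [ContinuousLinearMap.comp_apply, ContinuousLinearMap.proj_apply] at h
  rw [← h]
  simp only [Matrix.mulVec, dotProduct, Matrix.of_apply]
  exact Finset.sum_congr rfl fun l _ => by rw [pd_comp hF (by omega) l]

theorem fderiv_apply_eq_zero_of_le (hm : 0 < m) (hmn : m < n) (hF : DifferentiableAt ℝ F 0)
    (h2 : ∀ i : Fin (n - m + 1), ∀ l : Fin m, pd (comp F (m - 1 + i.val)) 0 l.val = 0)
    (x : Fin m → ℝ) (q : Fin n) (hq : m - 1 ≤ q.val) : fderiv ℝ F 0 x q = 0 := by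
  have h := sum_apply_single_mul
    ((ContinuousLinearMap.proj (R := ℝ) (φ := fun _ : Fin n => ℝ) q).comp
      (fderiv ℝ F 0)) x
  simp only [ContinuousLinearMap.comp_apply, ContinuousLinearMap.proj_apply] at h
  rw [← h]
  refine Finset.sum_eq_zero fun l _ => ?_
  have hq2 := h2 ⟨q.val - (m - 1), by omega⟩ l
  simp only [Nat.add_sub_cancel' hq] at hq2
  rw [pd_comp hF q.isLt] at hq2
  simp [hq2]

theorem fderiv_eq_zero_iff_mulVec (hm : 0 < m) (hmn : m < n) (hF : DifferentiableAt ℝ F 0)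
    (h2 : ∀ i : Fin (n - m + 1), ∀ l : Fin m, pd (comp F (m - 1 + i.val)) 0 l.val = 0)
    (x : Fin m → ℝ) :
    fderiv ℝ F 0 x = 0 ↔
      (Matrix.of fun (k : Fin (m - 1)) (l : Fin m) => pd (comp F k.val) 0 l.val) *ᵥ x = 0 := by
  constructor
  · intro h
    funext k
    rw [gradient_matrix_mulVec hmn hF, h]
    rfl
  · intro h
    funext q
    by_cases hq : m - 1 ≤ q.val
    · exact fderiv_apply_eq_zero_of_le hm hmn hF h2 x q hq
    · have := congrFun h ⟨q.val, by omega⟩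
      rwa [gradient_matrix_mulVec hmn hF] at this

/-- `dΛ_0` is the second derivative contracted with a nonzero kernel vector. -/
theorem exists_dLam_mulVec (hm : 0 < m) (hmn : m < n) (hF : ContDiffAt ℝ 2 F 0)
    (h1 : Matrix.rank (Matrix.of fun (k : Fin (m - 1)) (l : Fin m) =>
      pd (comp F k.val) 0 l.val) = m - 1)
    (h2 : ∀ i : Fin (n - m + 1), ∀ l : Fin m, pd (comp F (m - 1 + i.val)) 0 l.val = 0)
    {v : Fin m → ℝ} (hv : v ≠ 0) (hDv : fderiv ℝ F 0 v = 0) :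
    ∃ t : ℝ, t ≠ 0 ∧ ∀ (w : Fin m → ℝ) (i : Fin (n - m + 1)),
      (dLam F 0 *ᵥ w) i
        = t * fderiv ℝ (fderiv ℝ F) 0 w v ⟨m - 1 + i.val, by omega⟩ := by
  have hd : DifferentiableAt ℝ F 0 := hF.differentiableAt (by norm_num)
  have hd2 : DifferentiableAt ℝ (fderiv ℝ F) 0 :=
    (hF.fderiv_right (m := 1) (by norm_num)).differentiableAt (by norm_num)
  have hev : ∀ᶠ p in 𝓝 (0 : Fin m → ℝ), DifferentiableAt ℝ F p :=
    (hF.eventually (by simp)).mono fun p hp => hp.differentiableAt (by norm_num)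
  have hv0 := (fderiv_eq_zero_iff_mulVec hm hmn hd h2 v).1 hDv
  have hpd : ∀ (q : ℕ) (hq : q < n) (l : Fin m),
      HasFDerivAt (fun p => pd (comp F q) p l.val)
        ((ContinuousLinearMap.proj (R := ℝ) (φ := fun _ : Fin n => ℝ) ⟨q, hq⟩).comp
          ((fderiv ℝ (fderiv ℝ F) 0).flip (Pi.single l 1))) 0 := by
    intro q hq l
    have ha : HasFDerivAt (fun p => fderiv ℝ F p (Pi.single l 1) ⟨q, hq⟩)
        ((ContinuousLinearMap.proj (R := ℝ) (φ := fun _ : Fin n => ℝ) ⟨q, hq⟩).comp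
          ((fderiv ℝ (fderiv ℝ F) 0).flip (Pi.single l 1))) 0 := by
      have hb := hd2.hasFDerivAt.clm_apply
        (hasFDerivAt_const (Pi.single l (1 : ℝ) : Fin m → ℝ) (0 : Fin m → ℝ))
      have hc := hasFDerivAt_pi'.1 hb ⟨q, hq⟩
      refine hc.congr_fderiv ?_
      ext w
      simp
    exact ha.congr_of_eventuallyEq (hev.mono fun p hp => pd_comp hp hq l)
  let k₀ : Fin m := ⟨m - 1, by omega⟩
  let P : ℕ → (Fin m → ℝ) → Matrix (Fin m) (Fin m) ℝ := fun i p =>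
    Matrix.of fun k l => pd (comp F (if k.val < m - 1 then k.val else m - 1 + i)) p l.val
  have hlt : ∀ (i : Fin (n - m + 1)) (k : Fin m),
      (if k.val < m - 1 then k.val else m - 1 + i.val) < n := by
    intro i k
    split_ifs <;> omega
  have hP : ∀ (i : Fin (n - m + 1)) (k l : Fin m),
      DifferentiableAt ℝ (fun x => P i x k l) 0 :=
    fun i k l => (hpd _ (hlt i k) l).differentiableAt
  have hrow : ∀ (i : Fin (n - m + 1)) (l : Fin m), P i 0 k₀ l = 0 := by
    intro i l
    simpa [P, k₀] using h2 i l
  let c : Fin m → ℝ := fun l => (P 0 0).adjugate l k₀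
  have hc : ∀ (i : ℕ) (l : Fin m), (P i 0).adjugate l k₀ = c l := by
    intro i l
    simp only [c, Matrix.adjugate_apply]
    congr 1
    ext k j
    by_cases hk : k = k₀
    · subst hk
      simp
    · have : k.val < m - 1 := by
        have : k.val ≠ m - 1 := fun h => hk (Fin.ext h)
        omega
      simp [Matrix.updateRow_apply, hk, P, this]
  have hrowdot : ∀ (x : Fin m → ℝ) (k : Fin (m - 1)),
      ((Matrix.of fun (k : Fin (m - 1)) (l : Fin m) => pd (comp F k.val) 0 l.val) *ᵥ x) k
        = P 0 0 ⟨k.val, by omega⟩ ⬝ᵥ x := by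
    intro x k
    simp [Matrix.mulVec, dotProduct, P]
  have hc0 : c ≠ 0 := by
    refine adjugate_col_ne_zero k₀ (P 0 0) hv fun x hx => ?_
    refine exists_smul_eq_of_mulVec_eq_zero hm h1 hv hv0 ?_
    funext k
    rw [hrowdot]
    refine hx _ fun h => ?_
    have := congrArg Fin.val h
    simp only [k₀] at this
    omega
  have hMc : (Matrix.of fun (k : Fin (m - 1)) (l : Fin m) =>
      pd (comp F k.val) 0 l.val) *ᵥ c = 0 := by
    funext k
    rw [hrowdot]
    have hdet : (P 0 0).det = 0 := Matrix.det_eq_zero_of_row_eq_zero k₀ (hrow 0)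
    have := congrFun (congrFun (Matrix.mul_adjugate (P 0 0)) ⟨k.val, by omega⟩) k₀
    rw [hdet, zero_smul] at this
    simpa [Matrix.mul_apply, dotProduct] using this
  obtain ⟨t, ht⟩ := exists_smul_eq_of_mulVec_eq_zero hm h1 hv hv0 hMc
  refine ⟨t, fun h => hc0 (by rw [← ht, h, zero_smul]), fun w i => ?_⟩
  have hD : ∀ z, fderiv ℝ (fun x => Lam F x i) 0 z
      = fderiv ℝ (fderiv ℝ F) 0 z c ⟨m - 1 + i.val, by omega⟩ := by
    intro z
    have h := fderiv_det_of_row_eq_zero (hP i) k₀ (hrow i) z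
    refine (show _ = _ from h).trans ?_
    have hs := sum_apply_single_mul
      ((ContinuousLinearMap.proj (R := ℝ) (φ := fun _ : Fin n => ℝ)
        ⟨m - 1 + i.val, by omega⟩).comp (fderiv ℝ (fderiv ℝ F) 0 z)) c
    simp only [ContinuousLinearMap.comp_apply, ContinuousLinearMap.proj_apply] at hs
    rw [← hs]
    refine Finset.sum_congr rfl fun l _ => ?_
    have hk : (fun x => P i x k₀ l) = fun x => pd (comp F (m - 1 + i.val)) x l.val := by
      funext x
      simp [P, k₀]
    rw [hc, hk, (hpd _ (by omega) l).fderiv]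
    rfl
  have hsum := sum_apply_single_mul (fderiv ℝ (fun x => Lam F x i) 0) w
  have hcv : fderiv ℝ (fderiv ℝ F) 0 w c = t • fderiv ℝ (fderiv ℝ F) 0 w v := by
    rw [← ht, map_smul]
  rw [hD w, hcv] at hsum
  rw [← smul_eq_mul, ← Pi.smul_apply, ← hsum]
  simp only [Matrix.mulVec, dotProduct, dLam, Matrix.of_apply, pd]
  refine Finset.sum_congr rfl fun l _ => ?_
  congr 2
  funext k
  simp [Pi.single_apply, Fin.ext_iff]

theorem rank_dLam_eq_iff (hm : 0 < m) (hmn : m < n) (hF : ContDiffAt ℝ 2 F 0)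
    (h1 : Matrix.rank (Matrix.of fun (k : Fin (m - 1)) (l : Fin m) =>
      pd (comp F k.val) 0 l.val) = m - 1)
    (h2 : ∀ i : Fin (n - m + 1), ∀ l : Fin m, pd (comp F (m - 1 + i.val)) 0 l.val = 0)
    {v : Fin m → ℝ} (hv : v ≠ 0) (hDv : fderiv ℝ F 0 v = 0) :
    Matrix.rank (dLam F 0) = n - m + 1 ↔ SecondDerivOnto F v := by
  have hd : DifferentiableAt ℝ F 0 := hF.differentiableAt (by norm_num)
  obtain ⟨t, ht0, ht⟩ := exists_dLam_mulVec hm hmn hF h1 h2 hv hDv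
  rw [rank_eq_iff_mulVec_surjective]
  constructor
  · intro hs y
    obtain ⟨w, hw⟩ := hs fun i => t * y ⟨m - 1 + i.val, by omega⟩
    obtain ⟨u, hu⟩ := (rank_eq_iff_mulVec_surjective _).1 h1 fun k =>
      (y - fderiv ℝ (fderiv ℝ F) 0 w v) ⟨k.val, by omega⟩
    refine ⟨w, u, ?_⟩
    funext q
    rw [Pi.add_apply]
    by_cases hq : m - 1 ≤ q.val
    · rw [fderiv_apply_eq_zero_of_le hm hmn hd h2 u q hq, add_zero]
      have := congrFun hw ⟨q.val - (m - 1), by omega⟩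
      rw [ht] at this
      simpa [Nat.add_sub_cancel' hq] using mul_left_cancel₀ ht0 this
    · have := congrFun hu ⟨q.val, by omega⟩
      rw [gradient_matrix_mulVec hmn hd] at this
      simp only [Pi.sub_apply] at this
      rw [this]
      ring
  · intro hs z
    obtain ⟨w, u, h⟩ := hs fun q => if hq : m - 1 ≤ q.val then
      t⁻¹ * z ⟨q.val - (m - 1), by omega⟩ else 0
    refine ⟨w, ?_⟩
    funext i
    have hi := congrFun h ⟨m - 1 + i.val, by omega⟩
    rw [Pi.add_apply, fderiv_apply_eq_zero_of_le hm hmn hd h2 u _ (by simp), add_zero] at hi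
    rw [ht, hi]
    simp [ht0]

end Normalized

theorem bijective_of_det_ne_zero {k : ℕ} {L : (Fin k → ℝ) →L[ℝ] (Fin k → ℝ)}
    (h : LinearMap.det L.toLinearMap ≠ 0) : Function.Bijective L := by
  have := (LinearMap.isUnit_iff_isUnit_det L.toLinearMap).2 (isUnit_iff_ne_zero.2 h)
  exact (Module.End.isUnit_iff _).1 this

/-- The second derivative of `Φ ∘ f ∘ φ` in a kernel direction. -/
theorem fderiv_fderiv_comp_comp {m n : ℕ} {f g : (Fin m → ℝ) → (Fin n → ℝ)}
    {φ : (Fin m → ℝ) → (Fin m → ℝ)} {Φ : (Fin n → ℝ) → (Fin n → ℝ)}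
    (hf : ContDiffAt ℝ 2 f 0) (hf0 : f 0 = 0) (hφ : ContDiffAt ℝ 2 φ 0) (hφ0 : φ 0 = 0)
    (hΦ : ContDiffAt ℝ 2 Φ 0) (hg : ∀ᶠ x in 𝓝 (0 : Fin m → ℝ), g x = Φ (f (φ x))) :
    ContDiffAt ℝ 2 g 0 ∧
    (∀ u, fderiv ℝ g 0 u = fderiv ℝ Φ 0 (fderiv ℝ f 0 (fderiv ℝ φ 0 u))) ∧
    ∀ v, fderiv ℝ f 0 (fderiv ℝ φ 0 v) = 0 → ∀ w,
      fderiv ℝ (fderiv ℝ g) 0 w v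
        = fderiv ℝ Φ 0 (fderiv ℝ (fderiv ℝ f) 0 (fderiv ℝ φ 0 w) (fderiv ℝ φ 0 v)
            + fderiv ℝ f 0 (fderiv ℝ (fderiv ℝ φ) 0 w v)) := by
  have hf' : ContDiffAt ℝ 2 f (φ 0) := by rwa [hφ0]
  have hfφ : ContDiffAt ℝ 2 (fun x => f (φ x)) 0 := hf'.comp 0 hφ
  have hΦ' : ContDiffAt ℝ 2 Φ (f (φ 0)) := by rwa [hφ0, hf0]
  have hgc : ContDiffAt ℝ 2 g 0 :=
    (hΦ'.comp (0 : Fin m → ℝ) hfφ).congr_of_eventuallyEq hg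
  have hd : ∀ {a b : ℕ} {h : (Fin a → ℝ) → (Fin b → ℝ)} {p : Fin a → ℝ},
      ContDiffAt ℝ 2 h p → DifferentiableAt ℝ h p := fun h => h.differentiableAt (by norm_num)
  have hd2 : ∀ {a b : ℕ} {h : (Fin a → ℝ) → (Fin b → ℝ)} {p : Fin a → ℝ},
      ContDiffAt ℝ 2 h p → DifferentiableAt ℝ (fderiv ℝ h) p := fun h =>
    (h.fderiv_right (m := 1) (by norm_num)).differentiableAt (by norm_num)
  have hchain : ∀ᶠ x in 𝓝 (0 : Fin m → ℝ), ∀ u,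
      fderiv ℝ g x u = fderiv ℝ Φ (f (φ x)) (fderiv ℝ f (φ x) (fderiv ℝ φ x u)) := by
    filter_upwards [hg.eventually_nhds, hφ.eventually (by simp),
      hφ.continuousAt.eventually (hf'.eventually (by simp)),
      hfφ.continuousAt.eventually (hΦ'.eventually (by simp))] with x hx h1 h2 h3 u
    have he : g =ᶠ[𝓝 x] fun x => Φ (f (φ x)) := hx
    have hcomp := (hd h3).hasFDerivAt.comp x ((hd h2).hasFDerivAt.comp x (hd h1).hasFDerivAt)
    have hfd : fderiv ℝ g x = _ := he.fderiv_eq.trans hcomp.fderiv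
    rw [hfd]
    rfl
  refine ⟨hgc, fun u => ?_, fun v hv w => ?_⟩
  · rw [hchain.self_of_nhds u, hφ0, hf0]
  have hA : HasFDerivAt (fun x => fderiv ℝ Φ (f (φ x))) _ 0 :=
    (hd2 hΦ').hasFDerivAt.comp (0 : Fin m → ℝ) (hd hfφ).hasFDerivAt
  have hB : HasFDerivAt (fun x => fderiv ℝ f (φ x)) _ 0 :=
    (hd2 hf').hasFDerivAt.comp (0 : Fin m → ℝ) (hd hφ).hasFDerivAt
  have hC := (hd2 hφ).hasFDerivAt.clm_apply (hasFDerivAt_const v (0 : Fin m → ℝ))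
  have hR := hA.clm_apply (hB.clm_apply hC)
  have hL := (hd2 hgc).hasFDerivAt.clm_apply (hasFDerivAt_const v (0 : Fin m → ℝ))
  have heq := (hL.congr_of_eventuallyEq
    (hchain.mono fun x hx => (hx v).symm)).unique hR
  have := congrArg (fun L : (Fin m → ℝ) →L[ℝ] (Fin n → ℝ) => L w) heq
  simpa [hφ0, hf0, hv, add_comm] using this

theorem secondDerivOnto_comp_comp_iff {m n : ℕ} {f g : (Fin m → ℝ) → (Fin n → ℝ)}
    {A : (Fin m → ℝ) →L[ℝ] (Fin m → ℝ)} {B : (Fin n → ℝ) →L[ℝ] (Fin n → ℝ)}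
    (hA : Function.Surjective A) (hB : Function.Bijective B) {v : Fin m → ℝ}
    {S : (Fin m → ℝ) → (Fin m → ℝ)}
    (h1 : ∀ u, fderiv ℝ g 0 u = B (fderiv ℝ f 0 (A u)))
    (h2 : ∀ w, fderiv ℝ (fderiv ℝ g) 0 w v
      = B (fderiv ℝ (fderiv ℝ f) 0 (A w) (A v) + fderiv ℝ f 0 (S w))) :
    SecondDerivOnto g v ↔ SecondDerivOnto f (A v) := by
  constructor
  · intro h y
    obtain ⟨w, u, hwu⟩ := h (B y)
    refine ⟨A w, S w + A u, hB.1 ?_⟩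
    rw [← hwu, h1, h2, ← map_add, map_add (fderiv ℝ f 0), add_assoc]
  · intro h y
    obtain ⟨y, rfl⟩ := hB.2 y
    obtain ⟨w', u', rfl⟩ := h y
    obtain ⟨w, rfl⟩ := hA w'
    obtain ⟨u, hu⟩ := hA (u' - S w)
    refine ⟨w, u, ?_⟩
    rw [h1, h2, hu, ← map_add, map_sub]
    congr 1
    abel

/-- Non-degeneracy of the singular point `0` does not depend on the
choice of coordinate systems on source and target satisfying the normalization
conditions. -/
theorem stmt0 {m n : ℕ} (hm : 0 < m) (hmn : m < n)
    (f g : (Fin m → ℝ) → (Fin n → ℝ))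
    (hf : ContDiff ℝ (⊤ : ℕ∞) f) (hf0 : f 0 = 0)
    (hrankf : Matrix.rank (jac f 0) = m - 1)
    (hnormf1 : Matrix.rank (Matrix.of fun (k : Fin (m - 1)) (l : Fin m) =>
      pd (comp f k.val) 0 l.val) = m - 1)
    (hnormf2 : ∀ i : Fin (n - m + 1), ∀ l : Fin m, pd (comp f (m - 1 + i.val)) 0 l.val = 0)
    (φ : (Fin m → ℝ) → (Fin m → ℝ)) (Φ : (Fin n → ℝ) → (Fin n → ℝ))
    (hφ : IsDiffeoGerm φ) (hΦ : IsDiffeoGerm Φ)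
    (hg : ∀ᶠ x in 𝓝 (0 : Fin m → ℝ), g x = Φ (f (φ x)))
    (hnormg1 : Matrix.rank (Matrix.of fun (k : Fin (m - 1)) (l : Fin m) =>
      pd (comp g k.val) 0 l.val) = m - 1)
    (hnormg2 : ∀ i : Fin (n - m + 1), ∀ l : Fin m, pd (comp g (m - 1 + i.val)) 0 l.val = 0) :
    Matrix.rank (dLam g 0) = n - m + 1 ↔ Matrix.rank (dLam f 0) = n - m + 1 := by
  obtain ⟨hφ0, hφs, hφd⟩ := hφ
  obtain ⟨-, hΦs, hΦd⟩ := hΦ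
  have htwo : (2 : WithTop ℕ∞) ≤ ((⊤ : ℕ∞) : WithTop ℕ∞) := WithTop.coe_le_coe.2 le_top
  have hf2 : ContDiffAt ℝ 2 f 0 := hf.contDiffAt.of_le htwo
  obtain ⟨hg2, hg', hg''⟩ := fderiv_fderiv_comp_comp hf2 hf0 (hφs.of_le htwo) hφ0
    (hΦs.of_le htwo) hg
  have hA := bijective_of_det_ne_zero hφd
  have hB := bijective_of_det_ne_zero hΦd
  obtain ⟨⟨v, hMv⟩, hv, -⟩ :=
    finrank_eq_one_iff'.1 (finrank_ker_mulVecLin_eq_one hm hnormg1)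
  have hv0 : v ≠ 0 := by simpa [Subtype.ext_iff] using hv
  have hgv : fderiv ℝ g 0 v = 0 :=
    (fderiv_eq_zero_iff_mulVec hm hmn (hg2.differentiableAt (by norm_num)) hnormg2 v).2 hMv
  have hfv : fderiv ℝ f 0 (fderiv ℝ φ 0 v) = 0 :=
    hB.1 (by rw [← hg' v, hgv, map_zero])
  have hAv : fderiv ℝ φ 0 v ≠ 0 := fun h => hv0 (hA.1 (by rw [h, map_zero]))
  rw [rank_dLam_eq_iff hm hmn hg2 hnormg1 hnormg2 hv0 hgv,
    rank_dLam_eq_iff hm hmn hf2 hnormf1 hnormf2 hAv hfv]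
  exact secondDerivOnto_comp_comp_iff hA.2 hB hg' (hg'' v hfv)
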